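/- arXiv:math/0301146 — 5 statements merged into one kernel-verified Lean document; each statement's English description precedes it below -/
import Mathlib

section
/- Let A be a (not necessarily commutative) ring, m ≥ 0 an integer and p : {0,…,m} → ℕ₊ a family of positive integers. Consider the set P of parameters η = (η^{s,k}), where η^{s,k} is a p(s+k) × p(s) matrix with entries in A for 0 ≤ s ≤ m and 0 ≤ k ≤ m−s, with the convention η^{s,k} := 0 whenever the indices (s,k) lie outside this range. Then the operation (η₁ ∧ η₂)^{s,k} := η₁^{s,k} + η₂^{s,k} + Σ_{j=0}^{k} η₁^{s+j,k−j} · η₂^{s,j} (matrix product) is associative on P, and the zero parameter is a two-sided neutral element; in particular (P, ∧) is a monoid. -/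
/-- Cast of a rectangular matrix along equalities of its dimensions (junk value 0 if the
    dimensions do not agree). -/
def mcast {A : Type*} [Ring A] (a c : ℕ) {b d : ℕ} (M : Matrix (Fin b) (Fin d) A) :
    Matrix (Fin a) (Fin c) A :=
  if h : b = a ∧ d = c then M.submatrix (Fin.cast h.1.symm) (Fin.cast h.2.symm) else 0

/-- A parameter over the ring A relative to the dimension family p: a family of
    p(s+k) × p(s) matrices η^{s,k}. -/
def Param (A : Type*) [Ring A] (p : ℕ → ℕ) : Type _ :=
  ∀ s k : ℕ, Matrix (Fin (p (s + k))) (Fin (p s)) A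

/-- The support convention: η^{s,k} = 0 whenever (s,k) lies outside the range
    0 ≤ s ≤ m, 0 ≤ k ≤ m − s (equivalently, whenever s + k > m). -/
def InRange {A : Type*} [Ring A] {p : ℕ → ℕ} (m : ℕ) (η : Param A p) : Prop :=
  ∀ s k : ℕ, m < s + k → η s k = 0

/-- The product law (η₁ ∧ η₂)^{s,k} := η₁^{s,k} + η₂^{s,k} + Σ_{j=0}^{k} η₁^{s+j,k−j}·η₂^{s,j}
    on parameters. -/
def wedge {A : Type*} [Ring A] (p : ℕ → ℕ) (η₁ η₂ : Param A p) : Param A p :=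
  fun s k =>
    η₁ s k + η₂ s k +
      ∑ j ∈ Finset.range (k + 1), mcast (p (s + k)) (p s) (η₁ (s + j) (k - j) * η₂ s j)

section

variable {A : Type*} [Ring A]

theorem mcast_self {a c : ℕ} (M : Matrix (Fin a) (Fin c) A) : mcast a c M = M := by
  ext i j
  simp [mcast]

theorem mcast_zero (a c b d : ℕ) : mcast a c (0 : Matrix (Fin b) (Fin d) A) = 0 := by
  unfold mcast
  split <;> simp

theorem mcast_add (a c : ℕ) {b d : ℕ} (M N : Matrix (Fin b) (Fin d) A) :
    mcast a c (M + N) = mcast a c M + mcast a c N := by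
  unfold mcast
  split <;> simp [Matrix.submatrix_add]

theorem mcast_sum {ι : Type*} (t : Finset ι) (a c : ℕ) {b d : ℕ}
    (f : ι → Matrix (Fin b) (Fin d) A) :
    mcast a c (∑ i ∈ t, f i) = ∑ i ∈ t, mcast a c (f i) :=
  map_sum (AddMonoidHom.mk' (mcast a c) (mcast_add a c)) f t

theorem mcast_mul_assoc {a a' e b b' b'' c d : ℕ} {M : Matrix (Fin a) (Fin b) A}
    {M' : Matrix (Fin a') (Fin b') A} {N : Matrix (Fin b) (Fin c) A}
    {N' : Matrix (Fin b'') (Fin c) A} (L : Matrix (Fin c) (Fin d) A)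
    (ha : a = a') (hb : b = b') (hb' : b = b'') (he : a = e) (hM : HEq M M') (hN : HEq N N') :
    mcast e d (mcast e c (M * N) * L) = mcast e d (M' * mcast b' d (N' * L)) := by
  subst ha hb hb' he
  cases hM
  cases hN
  simp only [mcast_self, Matrix.mul_assoc]

theorem mcast_mcast_mul {a e c d b : ℕ} (h : a = e) (M : Matrix (Fin b) (Fin c) A)
    (L : Matrix (Fin c) (Fin d) A) :
    mcast e d (mcast a c M * L) = mcast e d (mcast e c M * L) := by
  rw [h]

/-- The bilinear part of the product law on parameters. -/
def Param.conv {p : ℕ → ℕ} (η₁ η₂ : Param A p) : Param A p :=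
  fun s k =>
    ∑ j ∈ Finset.range (k + 1), mcast (p (s + k)) (p s) (η₁ (s + j) (k - j) * η₂ s j)

namespace Param

variable {p : ℕ → ℕ}

theorem heq_of_eq (η : Param A p) {s s' k k' : ℕ} (hs : s = s') (hk : k = k') :
    HEq (η s k) (η s' k') := by
  subst hs hk
  rfl

theorem conv_assoc (η₁ η₂ η₃ : Param A p) :
    conv (conv η₁ η₂) η₃ = conv η₁ (conv η₂ η₃) := by
  funext s k
  simp only [conv, Matrix.sum_mul, Matrix.mul_sum, mcast_sum, Finset.sum_sigma']
  refine Finset.sum_bij' (fun x _ => ⟨x.1 + x.2, x.1⟩) (fun x _ => ⟨x.2, x.1 - x.2⟩)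
    ?_ ?_ ?_ ?_ ?_
  · rintro ⟨j, i⟩ h
    simp only [Finset.mem_sigma, Finset.mem_range] at h ⊢
    omega
  · rintro ⟨j, i⟩ h
    simp only [Finset.mem_sigma, Finset.mem_range] at h ⊢
    omega
  · rintro ⟨j, i⟩ h
    simp
  · rintro ⟨j, i⟩ h
    simp only [Finset.mem_sigma, Finset.mem_range] at h
    simp only [Sigma.mk.injEq, heq_eq_eq, and_true]
    omega
  · rintro ⟨j, i⟩ h
    simp only [Finset.mem_sigma, Finset.mem_range] at h
    have hk : s + j + (k - j) = s + k := by omega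
    rw [mcast_mcast_mul (congrArg p hk)]
    have hi : s + j + i = s + (j + i) := by omega
    have ht : s + j + i + (k - j - i) = s + (j + i) + (k - (j + i)) := by omega
    have he : s + j + i + (k - j - i) = s + k := by omega
    have hj : s + j + i = s + j + (j + i - j) := by omega
    exact mcast_mul_assoc _ (congrArg p ht) (congrArg p hi) (congrArg p hj) (congrArg p he)
      (heq_of_eq η₁ hi (Nat.sub_sub k j i))
      (heq_of_eq η₂ rfl (Nat.add_sub_cancel_left j i).symm)

theorem wedge_apply (η₁ η₂ : Param A p) (s k : ℕ) :
    wedge p η₁ η₂ s k = η₁ s k + η₂ s k + conv η₁ η₂ s k :=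
  rfl

theorem conv_wedge_left (η₁ η₂ η₃ : Param A p) (s k : ℕ) :
    conv (wedge p η₁ η₂) η₃ s k =
      conv η₁ η₃ s k + conv η₂ η₃ s k + conv (conv η₁ η₂) η₃ s k := by
  simp only [conv, wedge, Matrix.add_mul, mcast_add, Finset.sum_add_distrib]

theorem conv_wedge_right (η₁ η₂ η₃ : Param A p) (s k : ℕ) :
    conv η₁ (wedge p η₂ η₃) s k =
      conv η₁ η₂ s k + conv η₁ η₃ s k + conv η₁ (conv η₂ η₃) s k := by
  simp only [conv, wedge, Matrix.mul_add, mcast_add, Finset.sum_add_distrib]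

theorem wedge_assoc (η₁ η₂ η₃ : Param A p) :
    wedge p (wedge p η₁ η₂) η₃ = wedge p η₁ (wedge p η₂ η₃) := by
  funext s k
  rw [wedge_apply, wedge_apply, wedge_apply, wedge_apply, conv_wedge_left, conv_wedge_right, conv_assoc]
  abel

theorem zero_wedge (η : Param A p) : wedge p (fun _ _ => 0) η = η := by
  funext s k
  simp [wedge, mcast_zero]

theorem wedge_zero (η : Param A p) : wedge p η (fun _ _ => 0) = η := by
  funext s k
  simp [wedge, mcast_zero]

theorem inRange_wedge {m : ℕ} {η₁ η₂ : Param A p} (h₁ : InRange m η₁) (h₂ : InRange m η₂) :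
    InRange m (wedge p η₁ η₂) := by
  intro s k hk
  rw [wedge, h₁ s k hk, h₂ s k hk, add_zero, zero_add]
  refine Finset.sum_eq_zero fun j hj => ?_
  rw [Finset.mem_range] at hj
  rw [h₁ (s + j) (k - j) (by omega), Matrix.zero_mul, mcast_zero]

end Param

end

/-- the product ∧ preserves the set P of parameters satisfying the support
    convention, is associative on it, and the zero parameter is a two-sided neutral
    element; in particular (P, ∧) is a monoid. -/
theorem param_wedge_monoid {A : Type*} [Ring A] (m : ℕ) (p : ℕ → ℕ)
    (hp : ∀ s, 0 < p s) :
    (∀ η₁ η₂ : Param A p, InRange m η₁ → InRange m η₂ → InRange m (wedge p η₁ η₂)) ∧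
    (∀ η₁ η₂ η₃ : Param A p, InRange m η₁ → InRange m η₂ → InRange m η₃ →
      wedge p (wedge p η₁ η₂) η₃ = wedge p η₁ (wedge p η₂ η₃)) ∧
    (∀ η : Param A p, InRange m η →
      wedge p (fun _ _ => 0) η = η ∧ wedge p η (fun _ _ => 0) = η) := by
  exact ⟨fun _ _ => Param.inRange_wedge, fun η₁ η₂ η₃ _ _ _ => Param.wedge_assoc η₁ η₂ η₃,
    fun η _ => ⟨Param.zero_wedge η, Param.wedge_zero η⟩⟩
end

section
/- There exists ρ ∈ (0,1) such that for every r ∈ (0,ρ] the series Σ_{k≥0} α_k(r) and Σ_{k≥0} β_k(r) converge, and moreover lim_{r→0⁺} Σ_{k=0}^∞ α_k(r) = 0 and lim_{r→0⁺} Σ_{k=0}^∞ β_k(r) = 0. -/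
/-- s(h) := 2n + h + 2. -/
def sExp (n h : ℕ) : ℕ := 2 * n + h + 2

/-- ν(m,h) := ((m+2)·m + 1)·s(h). -/
def nuExp (n m h : ℕ) : ℕ := ((m + 2) * m + 1) * sExp n h

/-- σ_{m,j} := e^{−j−2} / (m+1). -/
noncomputable def sigm (m j : ℕ) : ℝ := Real.exp (-(j : ℝ) - 2) / (m + 1)

/-- α_k(r) := a₀(r)^{2^k} · ∏_{j=0}^{k−1} H^{2^{k−1−j}} · σ_{m,j}^{−ν(m,j)·2^{k−1−j}}. -/
noncomputable def alphaSeq (n m : ℕ) (H : ℝ) (a₀ : ℝ → ℝ) (k : ℕ) (r : ℝ) : ℝ :=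
  a₀ r ^ (2 ^ k) *
    ∏ j ∈ Finset.range k,
      H ^ (2 ^ (k - 1 - j)) * sigm m j ^ (-((nuExp n m j * 2 ^ (k - 1 - j) : ℕ) : ℤ))

/-- b₀(r) := H · σ_{m,0}^{−(m+1)·s(0)} · a₀(r). -/
noncomputable def bInit (n m : ℕ) (H : ℝ) (a₀ : ℝ → ℝ) (r : ℝ) : ℝ :=
  H * sigm m 0 ^ (-(((m + 1) * sExp n 0 : ℕ) : ℤ)) * a₀ r

/-- β_k(r) := b₀(r)^{2^k} · ∏_{j=0}^{k−1} P^{2^{k−1−j}} · e^{γ(m,j)·2^{k−1−j}},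
    with γ(m,j) = c₁·j + c₀. -/
noncomputable def betaSeq (n m : ℕ) (H P c₀ c₁ : ℝ) (a₀ : ℝ → ℝ) (k : ℕ) (r : ℝ) : ℝ :=
  bInit n m H a₀ r ^ (2 ^ k) *
    ∏ j ∈ Finset.range k,
      P ^ (2 ^ (k - 1 - j)) * Real.exp ((c₁ * j + c₀) * 2 ^ (k - 1 - j))

/-- The sequence `x ^ 2 ^ k * ∏ j < k, c j ^ 2 ^ (k - 1 - j)`, which solves the recursion
`T (k + 1) = T k ^ 2 * c k` with `T 0 = x`. -/
noncomputable def doublingProd (c : ℕ → ℝ) (x : ℝ) (k : ℕ) : ℝ :=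
  x ^ (2 ^ k) * ∏ j ∈ Finset.range k, c j ^ (2 ^ (k - 1 - j))

lemma doublingProd_zero (c : ℕ → ℝ) (x : ℝ) : doublingProd c x 0 = x := by
  simp [doublingProd]

lemma doublingProd_succ (c : ℕ → ℝ) (x : ℝ) (k : ℕ) :
    doublingProd c x (k + 1) = doublingProd c x k ^ 2 * c k := by
  have h : ∏ j ∈ Finset.range k, c j ^ (2 ^ (k - j)) =
      (∏ j ∈ Finset.range k, c j ^ (2 ^ (k - 1 - j))) ^ 2 := by
    rw [← Finset.prod_pow]
    refine Finset.prod_congr rfl fun j hj => ?_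
    have hj : j < k := Finset.mem_range.mp hj
    rw [← pow_mul, ← pow_succ]
    congr 2
    omega
  unfold doublingProd
  rw [Finset.prod_range_succ, Nat.add_sub_cancel, h, Nat.sub_self, pow_zero, pow_one, pow_succ,
    pow_mul, mul_pow]
  ring

lemma doublingProd_nonneg {c : ℕ → ℝ} (hc : ∀ j, 0 ≤ c j) {x : ℝ} (hx : 0 ≤ x) (k : ℕ) :
    0 ≤ doublingProd c x k :=
  mul_nonneg (pow_nonneg hx _) (Finset.prod_nonneg fun j _ => pow_nonneg (hc j) _)

lemma doublingProd_mul_pow_le {c : ℕ → ℝ} {B : ℝ} (hc : ∀ j, 0 ≤ c j) (hB : 1 ≤ B)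
    (hcB : ∀ j, c j ≤ B ^ ((j + 1) ^ 2)) {x : ℝ} (hx : 0 ≤ x) (k : ℕ) :
    doublingProd c x k * B ^ (k ^ 2 + 4 * k + 6) ≤ (B ^ 6 * x) ^ (2 ^ k) := by
  have hB0 : 0 ≤ B := zero_le_one.trans hB
  induction k with
  | zero => simp [doublingProd_zero, mul_comm]
  | succ k ih =>
    have hT := doublingProd_nonneg hc hx k
    calc doublingProd c x (k + 1) * B ^ ((k + 1) ^ 2 + 4 * (k + 1) + 6)
        = doublingProd c x k ^ 2 * (c k * B ^ ((k + 1) ^ 2 + 4 * (k + 1) + 6)) := by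
          rw [doublingProd_succ]; ring
      _ ≤ doublingProd c x k ^ 2 *
            (B ^ ((k + 1) ^ 2) * B ^ ((k + 1) ^ 2 + 4 * (k + 1) + 6)) := by
          gcongr
          exact hcB k
      _ = (doublingProd c x k * B ^ (k ^ 2 + 4 * k + 6)) ^ 2 := by
          rw [mul_pow, ← pow_add, ← pow_mul]
          congr 2
          ring
      _ ≤ ((B ^ 6 * x) ^ (2 ^ k)) ^ 2 := by gcongr
      _ = (B ^ 6 * x) ^ (2 ^ (k + 1)) := by rw [← pow_mul, ← pow_succ]

lemma doublingProd_le_pow {c : ℕ → ℝ} {B : ℝ} (hc : ∀ j, 0 ≤ c j) (hB : 1 ≤ B)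
    (hcB : ∀ j, c j ≤ B ^ ((j + 1) ^ 2)) {x : ℝ} (hx : 0 ≤ x) (hx1 : B ^ 6 * x ≤ 1) (k : ℕ) :
    doublingProd c x k ≤ (B ^ 6 * x) * (B ^ 6 * x) ^ k := by
  have hy : 0 ≤ B ^ 6 * x := by positivity
  calc doublingProd c x k ≤ doublingProd c x k * B ^ (k ^ 2 + 4 * k + 6) :=
        le_mul_of_one_le_right (doublingProd_nonneg hc hx k) (one_le_pow₀ hB)
    _ ≤ (B ^ 6 * x) ^ (2 ^ k) := doublingProd_mul_pow_le hc hB hcB hx k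
    _ ≤ (B ^ 6 * x) ^ (k + 1) := pow_le_pow_of_le_one hy hx1 k.lt_two_pow_self
    _ = (B ^ 6 * x) * (B ^ 6 * x) ^ k := pow_succ' _ _

lemma doublingProd_summable_and_tsum_le {c : ℕ → ℝ} {B : ℝ} (hc : ∀ j, 0 ≤ c j) (hB : 1 ≤ B)
    (hcB : ∀ j, c j ≤ B ^ ((j + 1) ^ 2)) {x : ℝ} (hx : 0 ≤ x) (hx1 : B ^ 6 * x ≤ 1 / 2) :
    Summable (doublingProd c x) ∧ ∑' k, doublingProd c x k ≤ 2 * (B ^ 6 * x) := by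
  have hy : 0 ≤ B ^ 6 * x := by positivity
  have hle := doublingProd_le_pow hc hB hcB hx (hx1.trans (by norm_num))
  have hgeom := (hasSum_geometric_of_lt_one hy (by linarith)).mul_left (B ^ 6 * x)
  have hs : Summable (doublingProd c x) :=
    hgeom.summable.of_nonneg_of_le (doublingProd_nonneg hc hx) hle
  refine ⟨hs, (hs.tsum_le_tsum hle hgeom.summable).trans ?_⟩
  rw [hgeom.tsum_eq, mul_comm]
  refine mul_le_mul_of_nonneg_right ?_ hy
  rw [inv_le_comm₀ (by linarith) two_pos]
  linarith

lemma doublingProd_eventually_summable_and_tendsto {ι : Type*} {l : Filter ι} {c : ℕ → ℝ} {B : ℝ}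
    (hc : ∀ j, 0 ≤ c j) (hB : 1 ≤ B) (hcB : ∀ j, c j ≤ B ^ ((j + 1) ^ 2)) {x : ι → ℝ}
    (hx : ∀ᶠ r in l, 0 ≤ x r) (hlim : Filter.Tendsto x l (nhds 0)) :
    (∀ᶠ r in l, Summable (doublingProd c (x r))) ∧
      Filter.Tendsto (fun r => ∑' k, doublingProd c (x r) k) l (nhds 0) := by
  have hy : Filter.Tendsto (fun r => B ^ 6 * x r) l (nhds 0) := by
    simpa using hlim.const_mul (B ^ 6)
  have hsmall : ∀ᶠ r in l, B ^ 6 * x r ≤ 1 / 2 := hy.eventually_le_const (by norm_num)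
  constructor
  · filter_upwards [hx, hsmall] with r h0 h1
    exact (doublingProd_summable_and_tsum_le hc hB hcB h0 h1).1
  · refine tendsto_of_tendsto_of_tendsto_of_le_of_le' tendsto_const_nhds
      (by simpa using hy.const_mul 2) ?_ ?_
    · filter_upwards [hx] with r h0
      exact tsum_nonneg (doublingProd_nonneg hc h0)
    · filter_upwards [hx, hsmall] with r h0 h1
      exact (doublingProd_summable_and_tsum_le hc hB hcB h0 h1).2

lemma sigm_pos (m j : ℕ) : 0 < sigm m j := by
  unfold sigm
  positivity

lemma alphaSeq_eq_doublingProd (n m : ℕ) (H : ℝ) (a₀ : ℝ → ℝ) (k : ℕ) (r : ℝ) :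
    alphaSeq n m H a₀ k r =
      doublingProd (fun j => H * (sigm m j)⁻¹ ^ nuExp n m j) (a₀ r) k := by
  unfold alphaSeq doublingProd
  congr 1
  refine Finset.prod_congr rfl fun j _ => ?_
  rw [mul_pow, ← pow_mul, zpow_neg, zpow_natCast, inv_pow]

lemma betaSeq_eq_doublingProd (n m : ℕ) (H P c₀ c₁ : ℝ) (a₀ : ℝ → ℝ) (k : ℕ) (r : ℝ) :
    betaSeq n m H P c₀ c₁ a₀ k r =
      doublingProd (fun j => P * Real.exp (c₁ * j + c₀)) (bInit n m H a₀ r) k := by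
  unfold betaSeq doublingProd
  congr 1
  refine Finset.prod_congr rfl fun j _ => ?_
  rw [mul_pow, ← Real.exp_nat_mul]
  push_cast
  rw [mul_comm (c₁ * j + c₀)]

lemma sigm_inv_le (m j : ℕ) : (sigm m j)⁻¹ ≤ ((m + 1) * Real.exp 2) ^ (j + 1) := by
  have h : (sigm m j)⁻¹ = (m + 1) * Real.exp (j + 2) := by
    rw [sigm, inv_div, div_eq_mul_inv, ← Real.exp_neg]
    congr 2
    ring
  rw [h, mul_pow, ← Real.exp_nat_mul]
  gcongr
  · exact le_self_pow₀ (by simp) (by omega)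
  · push_cast
    have : (0 : ℝ) ≤ j := j.cast_nonneg
    linarith

lemma nuExp_le (n m j : ℕ) : nuExp n m j ≤ (j + 1) * nuExp n m 0 := by
  unfold nuExp sExp
  rw [mul_left_comm]
  gcongr
  nlinarith [Nat.zero_le (j * n)]

lemma exists_pow_sq_bound_alpha (n m : ℕ) (H : ℝ) :
    ∃ B : ℝ, 1 ≤ B ∧ ∀ j, H * (sigm m j)⁻¹ ^ nuExp n m j ≤ B ^ ((j + 1) ^ 2) := by
  set D : ℝ := (m + 1) * Real.exp 2 with hDdef
  have hD : 1 ≤ D :=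
    one_le_mul_of_one_le_of_one_le (by simp) (Real.one_le_exp (by norm_num))
  have hM : 1 ≤ max 1 H := le_max_left _ _
  refine ⟨max 1 H * D ^ nuExp n m 0, one_le_mul_of_one_le_of_one_le hM (one_le_pow₀ hD),
    fun j => ?_⟩
  have hσ : 0 ≤ (sigm m j)⁻¹ := (inv_pos.mpr (sigm_pos m j)).le
  have h1 : H ≤ max 1 H ^ ((j + 1) ^ 2) :=
    (le_max_right _ _).trans (le_self_pow₀ hM (by positivity))
  have h2 : (sigm m j)⁻¹ ^ nuExp n m j ≤ (D ^ nuExp n m 0) ^ ((j + 1) ^ 2) :=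
    calc (sigm m j)⁻¹ ^ nuExp n m j ≤ (D ^ (j + 1)) ^ nuExp n m j := by
          gcongr
          exact sigm_inv_le m j
      _ ≤ (D ^ (j + 1)) ^ ((j + 1) * nuExp n m 0) :=
          pow_le_pow_right₀ (one_le_pow₀ hD) (nuExp_le n m j)
      _ = (D ^ nuExp n m 0) ^ ((j + 1) ^ 2) := by
          rw [← pow_mul, ← pow_mul]
          congr 1
          ring
  rw [mul_pow]
  exact mul_le_mul h1 h2 (pow_nonneg hσ _) (by positivity)

lemma exists_pow_sq_bound_beta (P c₀ c₁ : ℝ) :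
    ∃ B : ℝ, 1 ≤ B ∧ ∀ j : ℕ, P * Real.exp (c₁ * j + c₀) ≤ B ^ ((j + 1) ^ 2) := by
  have hM : 1 ≤ max 1 P := le_max_left _ _
  refine ⟨max 1 P * Real.exp (|c₁| + |c₀|),
    one_le_mul_of_one_le_of_one_le hM (Real.one_le_exp (by positivity)), fun j => ?_⟩
  rw [mul_pow, ← Real.exp_nat_mul]
  refine mul_le_mul ((le_max_right _ _).trans (le_self_pow₀ hM (by positivity)))
    (Real.exp_le_exp.mpr ?_) (Real.exp_pos _).le (by positivity)
  have hj : (0 : ℝ) ≤ j := j.cast_nonneg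
  have h1 : (j : ℝ) ≤ (j + 1) ^ 2 := by nlinarith
  have h2 : (1 : ℝ) ≤ (j + 1) ^ 2 := by nlinarith
  push_cast
  calc c₁ * j + c₀ ≤ |c₁| * j + 1 * |c₀| := by
        rw [one_mul]
        gcongr
        · exact le_abs_self c₁
        · exact le_abs_self c₀
    _ ≤ |c₁| * (j + 1) ^ 2 + (j + 1) ^ 2 * |c₀| := by gcongr
    _ = (j + 1) ^ 2 * (|c₁| + |c₀|) := by ring

/-- Lemma of Section 3.4.2, parts (A) and (B): there is ρ ∈ (0,1) such that
    for every r ∈ (0,ρ] the series Σ_k α_k(r) and Σ_k β_k(r) converge, and moreover the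
    sums Σ_{k=0}^∞ α_k(r) and Σ_{k=0}^∞ β_k(r) tend to 0 as r → 0⁺. -/
theorem exists_radius_summable_and_sums_tendsto_zero (n m : ℕ) (hn : 1 ≤ n)
    (H P c₀ c₁ : ℝ) (hH : 0 < H) (hP : 0 < P) (hc₁ : 0 < c₁) (a₀ : ℝ → ℝ)
    (ha_nonneg : ∀ r : ℝ, 0 < r → r ≤ 1 → 0 ≤ a₀ r)
    (ha_mono : ∀ r₁ r₂ : ℝ, 0 < r₁ → r₁ ≤ r₂ → r₂ ≤ 1 → a₀ r₁ ≤ a₀ r₂)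
    (ha_lim : Filter.Tendsto a₀ (nhdsWithin 0 (Set.Ioi 0)) (nhds 0)) :
    (∃ ρ ∈ Set.Ioo (0 : ℝ) 1, ∀ r ∈ Set.Ioc (0 : ℝ) ρ,
      Summable (fun k => alphaSeq n m H a₀ k r) ∧
      Summable (fun k => betaSeq n m H P c₀ c₁ a₀ k r)) ∧
    Filter.Tendsto (fun r => ∑' k : ℕ, alphaSeq n m H a₀ k r)
      (nhdsWithin 0 (Set.Ioi 0)) (nhds 0) ∧
    Filter.Tendsto (fun r => ∑' k : ℕ, betaSeq n m H P c₀ c₁ a₀ k r)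
      (nhdsWithin 0 (Set.Ioi 0)) (nhds 0) := by
  have ha : ∀ᶠ r in nhdsWithin (0 : ℝ) (Set.Ioi 0), 0 ≤ a₀ r := by
    filter_upwards [Ioc_mem_nhdsGT (zero_lt_one' ℝ)] with r hr
    exact ha_nonneg r hr.1 hr.2
  have hb : ∀ᶠ r in nhdsWithin (0 : ℝ) (Set.Ioi 0), 0 ≤ bInit n m H a₀ r := by
    filter_upwards [ha] with r hr
    exact mul_nonneg (mul_nonneg hH.le (zpow_nonneg (sigm_pos m 0).le _)) hr
  have hb_lim : Filter.Tendsto (bInit n m H a₀) (nhdsWithin 0 (Set.Ioi 0)) (nhds 0) := by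
    have h := ha_lim.const_mul (H * sigm m 0 ^ (-(((m + 1) * sExp n 0 : ℕ) : ℤ)))
    rwa [mul_zero] at h
  obtain ⟨A, hA, hcA⟩ := exists_pow_sq_bound_alpha n m H
  obtain ⟨B, hB, hcB⟩ := exists_pow_sq_bound_beta P c₀ c₁
  obtain ⟨hα, hα_lim⟩ := doublingProd_eventually_summable_and_tendsto
    (fun j => mul_nonneg hH.le (pow_nonneg (inv_pos.mpr (sigm_pos m j)).le _)) hA hcA ha ha_lim
  obtain ⟨hβ, hβ_lim⟩ := doublingProd_eventually_summable_and_tendsto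
    (fun j => mul_nonneg hP.le (Real.exp_pos _).le) hB hcB hb hb_lim
  simp only [alphaSeq_eq_doublingProd, betaSeq_eq_doublingProd]
  refine ⟨?_, hα_lim, hβ_lim⟩
  obtain ⟨ε, hε, h⟩ := mem_nhdsGT_iff_exists_Ioc_subset.mp (hα.and hβ)
  have hε : 0 < ε := hε
  exact ⟨min ε (1 / 2), ⟨by positivity, (min_le_right _ _).trans_lt (by norm_num)⟩,
    fun r hr => h ⟨hr.1, hr.2.trans (min_le_left _ _)⟩⟩
end

section
/- For every sequence (A_k)_{k≥1} of nonnegative real numbers there exists a sequence (S_k)_{k≥0} of strictly positive real numbers with S_0 = 1 such that: (i) S_k ≤ D_k · S_j · S_{k−j} for every k ≥ 2 and every 1 ≤ j ≤ k−1, and (ii) S_k · A_k ≤ 2^{−k} for every k ≥ 1. -/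
/-- The constant Dₖ := ( max_{α,β ∈ ℕ^d, |α+β| = k} ∏ᵢ binom(αᵢ+βᵢ, αᵢ) )⁻¹ of the paper,
    the maximum being taken over the (finite, since every entry is at most k) set of pairs
    of multi-indices α, β ∈ ℕ^d with |α + β| = k. -/
noncomputable def Dwt (d k : ℕ) : ℝ :=
  ((((Finset.univ : Finset ((Fin d → Fin (k + 1)) × (Fin d → Fin (k + 1)))).filter
      (fun q => (∑ i, ((q.1 i : ℕ) + (q.2 i : ℕ))) = k)).sup
      (fun q => ∏ i, Nat.choose ((q.1 i : ℕ) + (q.2 i : ℕ)) (q.1 i)) : ℕ) : ℝ)⁻¹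

theorem Dwt_pos (d k : ℕ) (hd : 1 ≤ d) : 0 < Dwt d k := by
  obtain ⟨n, rfl⟩ : ∃ n, d = n + 1 := ⟨d - 1, by omega⟩
  unfold Dwt
  rw [inv_pos, Nat.cast_pos]
  have hmem : ((Pi.single 0 (Fin.last k), 0) :
      (Fin (n + 1) → Fin (k + 1)) × (Fin (n + 1) → Fin (k + 1))) ∈
      (Finset.univ.filter fun q => (∑ i, ((q.1 i : ℕ) + (q.2 i : ℕ))) = k) := by
    simp [Fin.sum_univ_succ]
  refine lt_of_lt_of_le ?_ (Finset.le_sup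
    (f := fun q : (Fin (n + 1) → Fin (k + 1)) × (Fin (n + 1) → Fin (k + 1)) =>
      ∏ i, Nat.choose ((q.1 i : ℕ) + (q.2 i : ℕ)) (q.1 i)) hmem)
  exact Finset.prod_pos fun i _ => Nat.choose_pos (Nat.le_add_right _ _)

/-- The sequence with `S 0 = 1` and `S (k + 1) = c (k + 1) * S k ^ 2`. -/
noncomputable def squaredProduct (c : ℕ → ℝ) : ℕ → ℝ
  | 0 => 1
  | k + 1 => c (k + 1) * squaredProduct c k ^ 2

section squaredProduct

variable {c : ℕ → ℝ}

theorem squaredProduct_pos (hc : ∀ k, 1 ≤ k → 0 < c k) (k : ℕ) : 0 < squaredProduct c k := by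
  induction k with
  | zero => exact one_pos
  | succ k ih => exact mul_pos (hc _ (by omega)) (pow_pos ih 2)

theorem squaredProduct_le_one (hc : ∀ k, 1 ≤ k → 0 < c k) (hc1 : ∀ k, c k ≤ 1) (k : ℕ) :
    squaredProduct c k ≤ 1 := by
  induction k with
  | zero => exact le_rfl
  | succ k ih =>
    exact mul_le_one₀ (hc1 _) (by positivity)
      (pow_le_one₀ (squaredProduct_pos hc k).le ih)

theorem squaredProduct_antitone (hc : ∀ k, 1 ≤ k → 0 < c k) (hc1 : ∀ k, c k ≤ 1) :
    Antitone (squaredProduct c) := by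
  refine antitone_nat_of_succ_le fun k => ?_
  calc c (k + 1) * squaredProduct c k ^ 2
      ≤ squaredProduct c k ^ 2 := mul_le_of_le_one_left (by positivity) (hc1 _)
    _ ≤ squaredProduct c k :=
      pow_le_of_le_one (squaredProduct_pos hc k).le (squaredProduct_le_one hc hc1 k) two_ne_zero

theorem squaredProduct_le_mul (hc : ∀ k, 1 ≤ k → 0 < c k) (hc1 : ∀ k, c k ≤ 1)
    {k j : ℕ} (hj : 1 ≤ j) (hjk : j < k) :
    squaredProduct c k ≤ c k * squaredProduct c j * squaredProduct c (k - j) := by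
  obtain ⟨n, rfl⟩ : ∃ n, k = n + 1 := ⟨k - 1, by omega⟩
  have hanti := squaredProduct_antitone hc hc1
  calc c (n + 1) * squaredProduct c n ^ 2
      = c (n + 1) * (squaredProduct c n * squaredProduct c n) := by rw [sq]
    _ ≤ c (n + 1) * (squaredProduct c j * squaredProduct c (n + 1 - j)) :=
      mul_le_mul_of_nonneg_left
        (mul_le_mul (hanti (by omega)) (hanti (by omega)) (squaredProduct_pos hc n).le
          (squaredProduct_pos hc j).le) (hc _ (by omega)).le
    _ = c (n + 1) * squaredProduct c j * squaredProduct c (n + 1 - j) := by rw [mul_assoc]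

theorem squaredProduct_le_self (hc : ∀ k, 1 ≤ k → 0 < c k) (hc1 : ∀ k, c k ≤ 1)
    {k : ℕ} (hk : 1 ≤ k) : squaredProduct c k ≤ c k := by
  obtain ⟨n, rfl⟩ : ∃ n, k = n + 1 := ⟨k - 1, by omega⟩
  exact mul_le_of_le_one_right (hc _ hk).le
    (pow_le_one₀ (squaredProduct_pos hc n).le (squaredProduct_le_one hc hc1 n))

end squaredProduct

/-- existence of the weight sequence (S_k) with S₀ = 1, S_k > 0,
    S_k ≤ D_k · S_j · S_{k−j} (2 ≤ k, 1 ≤ j ≤ k−1) and S_k · A_k ≤ 2^{−k} (k ≥ 1). -/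
theorem exists_weight_sequence (d : ℕ) (hd : 1 ≤ d) (A : ℕ → ℝ)
    (hA : ∀ k, 1 ≤ k → 0 ≤ A k) :
    ∃ S : ℕ → ℝ, S 0 = 1 ∧ (∀ k, 0 < S k) ∧
      (∀ k j, 2 ≤ k → 1 ≤ j → j ≤ k - 1 → S k ≤ Dwt d k * S j * S (k - j)) ∧
      (∀ k, 1 ≤ k → S k * A k ≤ (1 / 2 : ℝ) ^ k) := by
  let c : ℕ → ℝ := fun k => min 1 (min (Dwt d k) ((1 / 2 : ℝ) ^ k / (1 + A k)))
  have hc : ∀ k, 1 ≤ k → 0 < c k := fun k hk => by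
    have := hA k hk
    exact lt_min one_pos (lt_min (Dwt_pos d k hd) (by positivity))
  have hc1 : ∀ k, c k ≤ 1 := fun k => min_le_left _ _
  have hcD : ∀ k, c k ≤ Dwt d k := fun k => (min_le_right _ _).trans (min_le_left _ _)
  refine ⟨squaredProduct c, rfl, squaredProduct_pos hc, fun k j hk hj hjk => ?_, fun k hk => ?_⟩
  · refine (squaredProduct_le_mul hc hc1 hj (by omega)).trans ?_
    have hSj := squaredProduct_pos hc j
    have hSkj := squaredProduct_pos hc (k - j)
    gcongr
    exact hcD k
  · have hAk := hA k hk
    have hS : squaredProduct c k ≤ (1 / 2 : ℝ) ^ k / (1 + A k) :=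
      (squaredProduct_le_self hc hc1 hk).trans ((min_le_right _ _).trans (min_le_right _ _))
    rw [le_div_iff₀ (by positivity)] at hS
    linarith [squaredProduct_pos hc k]
end

section
/- Let (β_k)_{k≥0} be strictly positive real numbers with β_k ≤ 1 for all k and with β_{k+1}/β_k → 0 as k → ∞. Then for all integers h ≥ 0 and p ≥ 1: (i) the series Σ_{j ≥ h+p} binom(j−h−1, p−1) · β_{j−1} converges; and (ii) the sum Σ_{J ∈ J_h(p)} ∏_{r=1}^{p} β_{j_r − 1}, taken over all strictly increasing p-tuples J = (j_1 < … < j_p) of integers with j_1 ≥ h+1, is finite and bounded above by the series in (i). -/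
/-- If the ratios of consecutive terms of a positive sequence tend to zero, the sequence remains
summable after multiplication by any power of the index. -/
theorem summable_pow_mul_of_ratio_tendsto_zero {β : ℕ → ℝ} (hpos : ∀ k, 0 < β k)
    (hratio : Filter.Tendsto (fun k => β (k + 1) / β k) Filter.atTop (nhds 0)) (n : ℕ) :
    Summable (fun k : ℕ => ((k : ℝ) + 1) ^ n * β k) := by
  have hgpos (k : ℕ) : 0 < ((k : ℝ) + 1) ^ n * β k := mul_pos (by positivity) (hpos k)
  refine summable_of_ratio_test_tendsto_lt_one zero_lt_one
    (Filter.Eventually.of_forall fun k => (hgpos k).ne') ?_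
  have hquot : Filter.Tendsto (fun k : ℕ => 1 + 1 / ((k : ℝ) + 1)) Filter.atTop (nhds 1) := by
    simpa using (tendsto_const_nhds (x := (1 : ℝ))).add
      (tendsto_one_div_add_atTop_nhds_zero_nat (𝕜 := ℝ))
  have hprod := (hquot.pow n).mul hratio
  rw [mul_zero] at hprod
  refine hprod.congr fun k => ?_
  have hk : (k : ℝ) + 1 ≠ 0 := by positivity
  have hβ := (hpos k).ne'
  rw [Real.norm_of_nonneg (hgpos _).le, Real.norm_of_nonneg (hgpos _).le, mul_div_mul_comm,
    ← div_pow, one_add_div hk]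
  push_cast
  ring

/-- The series of binomially weighted terms of a positive sequence whose consecutive ratios tend
to zero converges. -/
theorem summable_choose_mul_of_ratio_tendsto_zero {β : ℕ → ℝ} (hpos : ∀ k, 0 < β k)
    (hratio : Filter.Tendsto (fun k => β (k + 1) / β k) Filter.atTop (nhds 0)) (h p n : ℕ) :
    Summable (fun j : ℕ =>
      if h + p ≤ j then (Nat.choose (j - h - 1) n : ℝ) * β (j - 1) else 0) := by
  rw [← summable_nat_add_iff 1]
  refine Summable.of_nonneg_of_le (fun k => ?_) (fun k => ?_)
    (summable_pow_mul_of_ratio_tendsto_zero hpos hratio n)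
  · have := (hpos (k + 1 - 1)).le
    positivity
  · have hβ := (hpos k).le
    split_ifs
    · have hchoose : Nat.choose (k + 1 - h - 1) n ≤ (k + 1) ^ n :=
        (Nat.choose_le_pow _ _).trans (Nat.pow_le_pow_left (by omega) n)
      rw [Nat.add_sub_cancel]
      gcongr
      exact_mod_cast hchoose
    · positivity

/-- A strictly increasing tuple of integers greater than `h`, encoded by its last entry together
with the set of its other entries. -/
def lastAndInitialSet (h n : ℕ)
    (J : {J : Fin (n + 1) → ℕ // StrictMono J ∧ ∀ r, h + 1 ≤ J r}) :
    Σ j : ℕ, {s : Finset ℕ // s ∈ (Finset.Ioo h j).powersetCard n} :=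
  ⟨J.1 (Fin.last n), Finset.univ.image fun r : Fin n => J.1 r.castSucc, by
    rw [Finset.mem_powersetCard]
    constructor
    · intro x hx
      obtain ⟨r, -, rfl⟩ := Finset.mem_image.1 hx
      exact Finset.mem_Ioo.2 ⟨J.2.2 _, J.2.1 (Fin.castSucc_lt_last r)⟩
    · have hinj : Function.Injective fun r : Fin n => J.1 r.castSucc :=
        J.2.1.injective.comp (Fin.castSucc_injective n)
      rw [Finset.card_image_of_injective _ hinj, Finset.card_univ, Fintype.card_fin]⟩

theorem lastAndInitialSet_injective (h n : ℕ) : Function.Injective (lastAndInitialSet h n) := by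
  intro J K hJK
  have hlast : J.1 (Fin.last n) = K.1 (Fin.last n) := congrArg Sigma.fst hJK
  have hinit : (Finset.univ.image fun r : Fin n => J.1 r.castSucc) =
      Finset.univ.image fun r : Fin n => K.1 r.castSucc :=
    congrArg (fun x : Σ j : ℕ, {s : Finset ℕ // s ∈ (Finset.Ioo h j).powersetCard n} =>
      x.2.1) hJK
  have hrange : Set.range (fun r : Fin n => J.1 r.castSucc) =
      Set.range fun r : Fin n => K.1 r.castSucc := by
    simpa using congrArg (fun s : Finset ℕ => (s : Set ℕ)) hinit
  have hfun := (StrictMono.range_inj (J.2.1.comp (Fin.strictMono_castSucc))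
    (K.2.1.comp (Fin.strictMono_castSucc))).1 hrange
  refine Subtype.ext (funext fun r => ?_)
  induction r using Fin.lastCases with
  | last => exact hlast
  | cast r => exact congrFun hfun r

/-- if 0 < β_k ≤ 1 and β_{k+1}/β_k → 0, then for h ≥ 0, p ≥ 1 the series
    Σ_{j ≥ h+p} binom(j−h−1, p−1)·β_{j−1} converges, and the sum over all strictly
    increasing p-tuples J = (j_1 < … < j_p) with j_1 ≥ h+1 of ∏_r β_{j_r − 1} is finite
    and bounded above by that series. -/
theorem combinatorial_series_convergence (β : ℕ → ℝ) (hpos : ∀ k, 0 < β k)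
    (hle : ∀ k, β k ≤ 1)
    (hratio : Filter.Tendsto (fun k => β (k + 1) / β k) Filter.atTop (nhds 0))
    (h p : ℕ) (hp : 1 ≤ p) :
    Summable (fun j : ℕ =>
      if h + p ≤ j then (Nat.choose (j - h - 1) (p - 1) : ℝ) * β (j - 1) else 0) ∧
    Summable (fun J : {J : Fin p → ℕ // StrictMono J ∧ ∀ r, h + 1 ≤ J r} =>
      ∏ r, β (J.1 r - 1)) ∧
    (∑' J : {J : Fin p → ℕ // StrictMono J ∧ ∀ r, h + 1 ≤ J r}, ∏ r, β (J.1 r - 1)) ≤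
      ∑' j : ℕ,
        (if h + p ≤ j then (Nat.choose (j - h - 1) (p - 1) : ℝ) * β (j - 1) else 0) := by
  obtain ⟨n, rfl⟩ : ∃ n, p = n + 1 := ⟨p - 1, by omega⟩
  have hseries := summable_choose_mul_of_ratio_tendsto_zero hpos hratio h (n + 1) n
  rw [Nat.add_sub_cancel]
  let w : (Σ j : ℕ, {s : Finset ℕ // s ∈ (Finset.Ioo h j).powersetCard n}) → ℝ :=
    fun x => if h + (n + 1) ≤ x.1 then β (x.1 - 1) else 0
  have hw_nonneg (x) : 0 ≤ w x := by
    have := (hpos (x.1 - 1)).le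
    positivity
  have hfiber (j : ℕ) : (∑' s, w ⟨j, s⟩) =
      if h + (n + 1) ≤ j then (Nat.choose (j - h - 1) n : ℝ) * β (j - 1) else 0 := by
    rw [tsum_fintype]
    simp [w, Finset.card_powersetCard]
  have hw : Summable w := by
    rw [summable_sigma_of_nonneg hw_nonneg]
    exact ⟨fun j => (hasSum_fintype _).summable, by simpa only [hfiber] using hseries⟩
  have hprod_nonneg (J : {J : Fin (n + 1) → ℕ // StrictMono J ∧ ∀ r, h + 1 ≤ J r}) :
      0 ≤ ∏ r, β (J.1 r - 1) := Finset.prod_nonneg fun r _ => (hpos _).le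
  have hprod_le (J : {J : Fin (n + 1) → ℕ // StrictMono J ∧ ∀ r, h + 1 ≤ J r}) :
      ∏ r, β (J.1 r - 1) ≤ w (lastAndInitialSet h n J) := by
    have hlast : h + (n + 1) ≤ J.1 (Fin.last n) := by
      have hmem := (lastAndInitialSet h n J).2.2
      have hcard := Finset.card_le_card (Finset.mem_powersetCard.1 hmem).1
      rw [(Finset.mem_powersetCard.1 hmem).2, Nat.card_Ioo] at hcard
      have hgt := J.2.2 (Fin.last n)
      change n ≤ J.1 (Fin.last n) - h - 1 at hcard
      omega
    have hw_eq : w (lastAndInitialSet h n J) = β (J.1 (Fin.last n) - 1) := if_pos hlast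
    rw [hw_eq, Fin.prod_univ_castSucc]
    exact mul_le_of_le_one_left (hpos _).le
      (Finset.prod_le_one (fun r _ => (hpos _).le) fun r _ => hle _)
  have hcomp := hw.comp_injective (lastAndInitialSet_injective h n)
  have htuples := Summable.of_nonneg_of_le hprod_nonneg hprod_le hcomp
  refine ⟨hseries, htuples, ?_⟩
  calc
    _ ≤ ∑' J, w (lastAndInitialSet h n J) := htuples.tsum_le_tsum hprod_le hcomp
    _ ≤ ∑' x, w x :=
      tsum_comp_le_tsum_of_inj hw hw_nonneg (lastAndInitialSet_injective h n)
    _ = _ := by rw [hw.tsum_sigma]; exact tsum_congr hfiber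
end

section
/- Let n ≥ 2, 0 ≤ l ≤ n−2, 1 ≤ j, κ ≤ n, and define k(ζ, z) := (conj(ζ_j) − conj(z_j)) · conj(ζ_κ) / ( ‖ζ − z‖^{2l+2} · ( Σ_{i=1}^{n} conj(ζ_i)·(ζ_i − z_i) )^{n−1−l} ). For every multi-index α ∈ ℕ^{2n} there exists a constant C > 0 (depending only on n and α) such that for all σ ∈ (0, 1/3] and all ζ, z ∈ ℂⁿ with ‖ζ‖ = 1 and ‖z‖ ≤ 1 − 3σ, one has |∂^α_z k(ζ, z)| ≤ C · σ^{−2n−|α|}. -/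
/-- Directional derivative of `f` along the vector `v`. -/
noncomputable def pderivAlong {E F : Type*} [NormedAddCommGroup E] [NormedSpace ℝ E]
    [NormedAddCommGroup F] [NormedSpace ℝ F] (v : E) (f : E → F) : E → F :=
  fun x => fderiv ℝ f x v

/-- Iterated directional derivatives along a list of vectors. -/
noncomputable def pderivIter {E F : Type*} [NormedAddCommGroup E] [NormedSpace ℝ E]
    [NormedAddCommGroup F] [NormedSpace ℝ F] (vs : List E) (f : E → F) : E → F :=
  vs.foldr pderivAlong f

/-- The 2n real coordinate directions of ℂⁿ ≅ ℝ^{2n}: the vectors e_i and i·e_i. -/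
noncomputable def coordVec (n : ℕ) : Fin n ⊕ Fin n → EuclideanSpace ℂ (Fin n)
  | Sum.inl i => EuclideanSpace.single i 1
  | Sum.inr i => EuclideanSpace.single i Complex.I

/-- The list of coordinate vectors attached to a multi-index α ∈ ℕ^{2n}: direction `i`
    repeated `α i` times; iterated differentiation along this list is the partial
    derivative ∂^α. -/
noncomputable def multiIndexVecs (n : ℕ) (α : Fin n ⊕ Fin n → ℕ) :
    List (EuclideanSpace ℂ (Fin n)) :=
  (((List.finRange n).map Sum.inl ++ (List.finRange n).map Sum.inr).flatMap
    fun i => List.replicate (α i) (coordVec n i))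

/-- On a list of directions, the iterated directional derivative of a sufficiently smooth function
is the corresponding value of its iterated Fréchet derivative. -/
theorem pderivIter_eq_iteratedFDeriv {E F : Type*} [NormedAddCommGroup E] [NormedSpace ℝ E]
    [NormedAddCommGroup F] [NormedSpace ℝ F] (vs : List E) {f : E → F} {x : E}
    (hf : ContDiffAt ℝ vs.length f x) :
    pderivIter vs f x = iteratedFDeriv ℝ vs.length f x vs.get := by
  induction vs generalizing x with
  | nil => simp [pderivIter]
  | cons v vs ih =>
    have hev : pderivIter vs f =ᶠ[nhds x] fun y => iteratedFDeriv ℝ vs.length f y vs.get := by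
      filter_upwards [hf.eventually (by simp)] with y hy
      exact ih (hy.of_le (by simp))
    have hd : DifferentiableAt ℝ (iteratedFDeriv ℝ vs.length f) x :=
      ContDiffAt.differentiableAt_iteratedFDeriv (n := ((vs.length + 1 : ℕ) : ℕ∞))
        (by simpa using hf) (by exact_mod_cast Nat.lt_succ_self _)
    change fderiv ℝ (pderivIter vs f) x v = _
    rw [hev.fderiv_eq, fderiv_continuousMultilinear_apply_const_apply hd]
    rfl

theorem norm_pderivIter_le {E F : Type*} [NormedAddCommGroup E] [NormedSpace ℝ E]
    [NormedAddCommGroup F] [NormedSpace ℝ F] {vs : List E} (hvs : ∀ v ∈ vs, ‖v‖ ≤ 1) {f : E → F}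
    {x : E} (hf : ContDiffAt ℝ vs.length f x) :
    ‖pderivIter vs f x‖ ≤ ‖iteratedFDeriv ℝ vs.length f x‖ := by
  rw [pderivIter_eq_iteratedFDeriv vs hf]
  refine ((iteratedFDeriv ℝ vs.length f x).le_opNorm _).trans
    (mul_le_of_le_one_right (norm_nonneg _) ?_)
  exact Finset.prod_le_one (fun _ _ => norm_nonneg _) fun i _ => hvs _ (List.get_mem vs i)

theorem norm_coordVec (n : ℕ) (i : Fin n ⊕ Fin n) : ‖coordVec n i‖ = 1 := by
  cases i <;> simp [coordVec]

theorem norm_le_one_of_mem_multiIndexVecs {n : ℕ} {α : Fin n ⊕ Fin n → ℕ}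
    {v : EuclideanSpace ℂ (Fin n)} (hv : v ∈ multiIndexVecs n α) : ‖v‖ ≤ 1 := by
  obtain ⟨i, -, hi⟩ := List.mem_flatMap.1 hv
  rw [List.eq_of_mem_replicate hi, norm_coordVec]

theorem length_multiIndexVecs (n : ℕ) (α : Fin n ⊕ Fin n → ℕ) :
    (multiIndexVecs n α).length = ∑ i, α i := by
  simp [multiIndexVecs, List.length_flatMap, Fintype.sum_sum_type, ← List.ofFn_eq_map,
    List.sum_ofFn, Function.comp_def]

section ScaledBounds

variable {E : Type*} [NormedAddCommGroup E] [NormedSpace ℝ E]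

theorem norm_iteratedFDeriv_affine_le {F : Type*} [NormedAddCommGroup F] [NormedSpace ℝ F]
    {f : E → F} {A : E →L[ℝ] F} (hf : ∀ x, HasFDerivAt f A x) {x : E} {M r : ℝ}
    (hx : ‖f x‖ ≤ M) (hA : ‖A‖ ≤ M * r) (hr : 0 ≤ r) (i : ℕ) :
    ‖iteratedFDeriv ℝ i f x‖ ≤ M * r ^ i := by
  have hM : 0 ≤ M := (norm_nonneg _).trans hx
  have hfd : fderiv ℝ f = fun _ => A := funext fun y => (hf y).fderiv
  match i with
  | 0 => simpa using hx
  | 1 => simpa [← norm_iteratedFDeriv_fderiv, hfd] using hA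
  | i + 2 =>
    rw [← norm_iteratedFDeriv_fderiv, hfd, iteratedFDeriv_succ_const]
    simp only [Pi.zero_apply, norm_zero]
    positivity

/-- If the derivatives of two functions grow geometrically with ratio `r`, the Leibniz sum for a
bilinear expression in them grows geometrically with ratio `2 * r`. -/
theorem leibniz_sum_le {a b : ℕ → ℝ} {A B r : ℝ} {m : ℕ} (hA : 0 ≤ A) (hr : 0 ≤ r)
    (hb0 : ∀ i, 0 ≤ b i) (ha : ∀ i ≤ m, a i ≤ A * r ^ i) (hb : ∀ i ≤ m, b i ≤ B * r ^ i) :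
    ∑ i ∈ Finset.range (m + 1), (m.choose i : ℝ) * a i * b (m - i) ≤ A * B * (2 * r) ^ m := by
  calc ∑ i ∈ Finset.range (m + 1), (m.choose i : ℝ) * a i * b (m - i)
      ≤ ∑ i ∈ Finset.range (m + 1), (m.choose i : ℝ) * (A * B * r ^ m) := by
        refine Finset.sum_le_sum fun i hi => ?_
        have him : i ≤ m := Nat.lt_succ_iff.1 (Finset.mem_range.1 hi)
        rw [mul_assoc]
        refine mul_le_mul_of_nonneg_left ?_ (by positivity)
        calc a i * b (m - i) ≤ (A * r ^ i) * (B * r ^ (m - i)) :=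
              mul_le_mul (ha i him) (hb _ (Nat.sub_le _ _)) (hb0 _) (by positivity)
          _ = A * B * (r ^ i * r ^ (m - i)) := by ring
          _ = A * B * r ^ m := by rw [← pow_add, Nat.add_sub_cancel' him]
    _ = A * B * (2 * r) ^ m := by
        rw [← Finset.sum_mul, ← Nat.cast_sum, Nat.sum_range_choose, mul_pow]
        push_cast
        ring

theorem norm_iteratedFDeriv_mul_le_of_geometric {f g : E → ℂ} {s : Set E} (hs : IsOpen s) {x : E}
    (hx : x ∈ s) {k : ℕ} (hf : ContDiffOn ℝ k f s) (hg : ContDiffOn ℝ k g s) {A B r : ℝ}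
    (hr : 0 ≤ r) (hA : 0 ≤ A) (hfb : ∀ i ≤ k, ‖iteratedFDeriv ℝ i f x‖ ≤ A * r ^ i)
    (hgb : ∀ i ≤ k, ‖iteratedFDeriv ℝ i g x‖ ≤ B * r ^ i) {m : ℕ} (hm : m ≤ k) :
    ‖iteratedFDeriv ℝ m (fun y => f y * g y) x‖ ≤ A * B * (2 * r) ^ m := by
  have h := norm_iteratedFDerivWithin_mul_le hf hg hs.uniqueDiffOn hx (n := m)
    (by exact_mod_cast hm)
  simp only [iteratedFDerivWithin_of_isOpen _ hs hx] at h
  exact h.trans (leibniz_sum_le (a := fun i => ‖iteratedFDeriv ℝ i f x‖)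
    (b := fun i => ‖iteratedFDeriv ℝ i g x‖) hA hr (fun _ => norm_nonneg _)
    (fun i hi => hfb i (hi.trans hm)) fun i hi => hgb i (hi.trans hm))

/-- Scale-invariant bound for the derivatives of the reciprocal of a power. -/
theorem exists_norm_iteratedFDeriv_inv_pow_le (k p : ℕ) :
    ∃ C : ℝ, 0 < C ∧ ∀ (f : E → ℂ) (s : Set E) (x : E) (r : ℝ), IsOpen s → x ∈ s →
      ContDiffOn ℝ k f s → (∀ y ∈ s, f y ≠ 0) → 0 ≤ r →
      (∀ i, 1 ≤ i → i ≤ k → ‖iteratedFDeriv ℝ i f x‖ ≤ ‖f x‖ * r ^ i) →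
      ∀ m ≤ k, ‖iteratedFDeriv ℝ m (fun y => (f y ^ p)⁻¹) x‖ ≤ C * (‖f x‖ ^ p)⁻¹ * r ^ m := by
  let g : ℂ → ℂ := fun u => (u ^ p)⁻¹
  let K : ℝ := ∑ i ∈ Finset.range (k + 1), ‖iteratedFDeriv ℝ i g 1‖
  have hK : 0 ≤ K := Finset.sum_nonneg fun _ _ => norm_nonneg _
  refine ⟨k.factorial * (K + 1), by positivity, ?_⟩
  intro f s x r hs hx hf hne hr hfb m hm
  have hc : f x ≠ 0 := hne x hx
  let h : E → ℂ := fun y => (f x)⁻¹ • f y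
  have hh : ContDiffOn ℝ k h s := hf.const_smul _
  have hopen : IsOpen ({0}ᶜ : Set ℂ) := isOpen_compl_singleton
  have hg : ContDiffOn ℝ k g {0}ᶜ :=
    (contDiff_id.pow p).contDiffOn.inv fun u hu => pow_ne_zero _ hu
  have hmaps : Set.MapsTo h s {0}ᶜ := fun y hy =>
    mul_ne_zero (inv_ne_zero hc) (hne y hy)
  have hx1 : h x = 1 := inv_mul_cancel₀ hc
  have hcomp := norm_iteratedFDerivWithin_comp_le hg hh (n := m) (by exact_mod_cast hm)
    hopen.uniqueDiffOn hs.uniqueDiffOn hmaps hx (C := K + 1) (D := r)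
    (fun i hi => by
      rw [hx1, iteratedFDerivWithin_of_isOpen _ hopen (by simp)]
      have := Finset.single_le_sum (f := fun i => ‖iteratedFDeriv ℝ i g 1‖)
        (fun _ _ => norm_nonneg _)
        (Finset.mem_range.2 (Nat.lt_succ_iff.2 (hi.trans hm)))
      simp only [K]
      linarith)
    (fun i hi1 hi => by
      have hfx : ContDiffAt ℝ i f x :=
        (hf.contDiffAt (hs.mem_nhds hx)).of_le (by exact_mod_cast hi.trans hm)
      rw [iteratedFDerivWithin_of_isOpen _ hs hx, iteratedFDeriv_const_smul_apply' hfx, norm_smul,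
        norm_inv]
      have hpos := norm_pos_iff.2 hc
      rw [inv_mul_le_iff₀ hpos]
      exact hfb i hi1 (hi.trans hm))
  rw [iteratedFDerivWithin_of_isOpen _ hs hx] at hcomp
  have hgh : ContDiffAt ℝ m (g ∘ h) x :=
    ((hg.comp hh hmaps).contDiffAt (hs.mem_nhds hx)).of_le (by exact_mod_cast hm)
  have heq : (fun y => (f y ^ p)⁻¹) = fun y => (f x ^ p)⁻¹ • (g ∘ h) y := by
    ext y
    simp only [g, h, Function.comp_apply, smul_eq_mul, mul_pow, mul_inv, inv_pow, inv_inv]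
    rw [inv_mul_cancel_left₀ (pow_ne_zero _ hc)]
  rw [heq, iteratedFDeriv_const_smul_apply' hgh, norm_smul, norm_inv, norm_pow]
  have hfac : (m.factorial : ℝ) ≤ k.factorial := by exact_mod_cast Nat.factorial_le hm
  calc (‖f x‖ ^ p)⁻¹ * ‖iteratedFDeriv ℝ m (g ∘ h) x‖
      ≤ (‖f x‖ ^ p)⁻¹ * (k.factorial * (K + 1) * r ^ m) := by
        gcongr
        exact hcomp.trans (by gcongr)
    _ = _ := by ring

end ScaledBounds

theorem norm_iteratedFDeriv_ofReal_norm_sub_sq_le {E : Type*} [NormedAddCommGroup E]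
    [InnerProductSpace ℝ E] {ζ x : E} (hx : x ≠ ζ) (i : ℕ) :
    ‖iteratedFDeriv ℝ i (fun w => ((‖ζ - w‖ ^ 2 : ℝ) : ℂ)) x‖ ≤
      ‖ζ - x‖ ^ 2 * (2 * ‖ζ - x‖⁻¹) ^ i := by
  have hd : 0 < ‖ζ - x‖ := norm_pos_iff.2 (sub_ne_zero.2 hx.symm)
  have hsub : ContDiff ℝ i (fun w : E => ζ - w) := contDiff_const.sub contDiff_id
  have hbd : ∀ j, ‖iteratedFDeriv ℝ j (fun w : E => ζ - w) x‖ ≤ ‖ζ - x‖ * ‖ζ - x‖⁻¹ ^ j :=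
    norm_iteratedFDeriv_affine_le (fun y => (hasFDerivAt_id y).const_sub ζ) le_rfl
      (by rw [mul_inv_cancel₀ hd.ne', norm_neg]; exact ContinuousLinearMap.norm_id_le)
      (by positivity)
  have hsq : ContDiff ℝ i (fun w : E => ‖ζ - w‖ ^ 2) := hsub.norm_sq ℝ
  have hiso := Complex.ofRealLI.norm_iteratedFDeriv_comp_left hsq.contDiffAt (x := x) le_rfl
  have hinner : (fun w : E => ‖ζ - w‖ ^ 2) = fun w => innerSL ℝ (ζ - w) (ζ - w) := by
    ext w
    rw [innerSL_apply_apply, real_inner_self_eq_norm_sq]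
  have hbil := (innerSL ℝ (E := E)).norm_iteratedFDeriv_le_of_bilinear_of_le_one hsub hsub x
    le_rfl (norm_innerSL_le ℝ)
  have hcomp : (fun w : E => ((‖ζ - w‖ ^ 2 : ℝ) : ℂ)) = Complex.ofRealLI ∘ fun w => ‖ζ - w‖ ^ 2 :=
    rfl
  rw [hcomp, hiso, hinner, sq]
  refine hbil.trans (leibniz_sum_le (a := fun i => ‖iteratedFDeriv ℝ i (fun w : E => ζ - w) x‖)
    (b := fun i => ‖iteratedFDeriv ℝ i (fun w : E => ζ - w) x‖) hd.le (by positivity)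
    (fun _ => norm_nonneg _) (fun i _ => hbd i) fun i _ => hbd i)

section Leray

variable {n : ℕ} {ζ : EuclideanSpace ℂ (Fin n)}

theorem sum_conj_mul_sub_eq_inner (ζ w : EuclideanSpace ℂ (Fin n)) :
    ∑ i, (starRingEnd ℂ) (ζ i) * (ζ i - w i) = inner ℂ ζ (ζ - w) := by
  simp only [PiLp.inner_apply, RCLike.inner_apply', PiLp.sub_apply]

theorem le_norm_leray_denominator (hζ : ‖ζ‖ = 1) (z : EuclideanSpace ℂ (Fin n)) :
    1 - ‖z‖ ≤ ‖∑ i, (starRingEnd ℂ) (ζ i) * (ζ i - z i)‖ := by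
  rw [sum_conj_mul_sub_eq_inner, inner_sub_right, inner_self_eq_norm_sq_to_K, hζ]
  have h1 := norm_sub_norm_le (1 : ℂ) (inner ℂ ζ z)
  have h2 := norm_inner_le_norm (𝕜 := ℂ) ζ z
  rw [hζ, one_mul] at h2
  rw [norm_one] at h1
  simp only [RCLike.ofReal_one, one_pow]
  linarith

theorem norm_iteratedFDeriv_leray_denominator_le (hζ : ‖ζ‖ = 1) {z : EuclideanSpace ℂ (Fin n)}
    {r : ℝ} (hLr : 1 ≤ ‖∑ i, (starRingEnd ℂ) (ζ i) * (ζ i - z i)‖ * r) (hr : 0 ≤ r) (i : ℕ) :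
    ‖iteratedFDeriv ℝ i (fun w : EuclideanSpace ℂ (Fin n) =>
      ∑ i, (starRingEnd ℂ) (ζ i) * (ζ i - w i)) z‖ ≤
      ‖∑ i, (starRingEnd ℂ) (ζ i) * (ζ i - z i)‖ * r ^ i := by
  let A : EuclideanSpace ℂ (Fin n) →L[ℝ] ℂ := (innerSL ℂ ζ).restrictScalars ℝ
  have hA : ‖-A‖ ≤ 1 := by
    rw [norm_neg]
    refine A.opNorm_le_bound zero_le_one fun w => ?_
    have h := norm_inner_le_norm (𝕜 := ℂ) ζ w
    rwa [hζ] at h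
  refine norm_iteratedFDeriv_affine_le (A := -A) (fun y => ?_) le_rfl (hA.trans hLr) hr i
  have heq : (fun w : EuclideanSpace ℂ (Fin n) => ∑ i, (starRingEnd ℂ) (ζ i) * (ζ i - w i)) =
      fun w => inner ℂ ζ ζ - A w := by
    ext w
    rw [sum_conj_mul_sub_eq_inner, inner_sub_right]
    rfl
  rw [heq]
  exact A.hasFDerivAt.const_sub _

theorem norm_iteratedFDeriv_leray_numerator_le (j κ : Fin n) (hζ : ‖ζ‖ = 1)
    {z : EuclideanSpace ℂ (Fin n)} (hz : ‖z‖ ≤ 1) {r : ℝ} (hr : 1 ≤ r) (i : ℕ) :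
    ‖iteratedFDeriv ℝ i (fun w : EuclideanSpace ℂ (Fin n) =>
      ((starRingEnd ℂ) (ζ j) - (starRingEnd ℂ) (w j)) * (starRingEnd ℂ) (ζ κ)) z‖ ≤
      2 * r ^ i := by
  have hκ : ‖ζ κ‖ ≤ 1 := hζ ▸ PiLp.norm_apply_le ζ κ
  let A : EuclideanSpace ℂ (Fin n) →L[ℝ] ℂ :=
    (ContinuousLinearMap.mul ℝ ℂ ((starRingEnd ℂ) (ζ κ))).comp
      ((Complex.conjCLE : ℂ →L[ℝ] ℂ).comp
        ((EuclideanSpace.proj j : EuclideanSpace ℂ (Fin n) →L[ℂ] ℂ).restrictScalars ℝ))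
  have hA : ‖-A‖ ≤ 1 := by
    rw [norm_neg]
    refine A.opNorm_le_bound zero_le_one fun w => ?_
    change ‖(starRingEnd ℂ) (ζ κ) * (starRingEnd ℂ) (w j)‖ ≤ 1 * ‖w‖
    rw [norm_mul, RCLike.norm_conj, RCLike.norm_conj]
    exact mul_le_mul hκ (PiLp.norm_apply_le w j) (norm_nonneg _) zero_le_one
  refine norm_iteratedFDeriv_affine_le (A := -A) (fun y => ?_) ?_ (by linarith) (by linarith) i
  · have heq : (fun w : EuclideanSpace ℂ (Fin n) =>
        ((starRingEnd ℂ) (ζ j) - (starRingEnd ℂ) (w j)) * (starRingEnd ℂ) (ζ κ)) =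
        fun w => (starRingEnd ℂ) (ζ κ) * (starRingEnd ℂ) (ζ j) - A w := by
      ext w
      change _ = _ - (starRingEnd ℂ) (ζ κ) * (starRingEnd ℂ) (w j)
      ring
    rw [heq]
    exact A.hasFDerivAt.const_sub _
  · rw [← map_sub, norm_mul, RCLike.norm_conj, RCLike.norm_conj]
    have h1 : ‖ζ j - z j‖ ≤ 2 := by
      have h := PiLp.norm_apply_le (ζ - z) j
      have h' := norm_sub_le ζ z
      rw [PiLp.sub_apply] at h
      linarith
    calc ‖ζ j - z j‖ * ‖ζ κ‖ ≤ 2 * 1 := mul_le_mul h1 hκ (norm_nonneg _) zero_le_two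
      _ = 2 := mul_one 2

end Leray

/-- for the boundary (Cauchy–Fantappiè type) kernel
    k(ζ,z) = (conj ζ_j − conj z_j)·conj ζ_κ /
             (‖ζ − z‖^{2l+2}·(Σᵢ conj ζ_i (ζ_i − z_i))^{n−1−l}),
    for every multi-index α there is a constant C > 0 (depending only on n and α) such
    that every multi-index z-derivative of order |α| is bounded by C·σ^{−2n−|α|} for ζ on
    the unit sphere and ‖z‖ ≤ 1 − 3σ, σ ∈ (0,1/3]. -/
theorem boundary_kernel_derivative_estimate (n : ℕ) (hn : 2 ≤ n)
    (α : Fin n ⊕ Fin n → ℕ) :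
    ∃ C : ℝ, 0 < C ∧ ∀ l : ℕ, l ≤ n - 2 → ∀ j κ : Fin n,
      ∀ σ ∈ Set.Ioc (0 : ℝ) (1 / 3),
      ∀ ζ z : EuclideanSpace ℂ (Fin n), ‖ζ‖ = 1 → ‖z‖ ≤ 1 - 3 * σ →
      ‖pderivIter (multiIndexVecs n α)
          (fun w => ((starRingEnd ℂ) (ζ j) - (starRingEnd ℂ) (w j)) * (starRingEnd ℂ) (ζ κ) /
            (((‖ζ - w‖ : ℝ) : ℂ) ^ (2 * l + 2) *
              (∑ i, (starRingEnd ℂ) (ζ i) * (ζ i - w i)) ^ (n - 1 - l))) z‖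
        ≤ C * σ ^ (-(2 * (n : ℤ) + ((∑ i, α i : ℕ) : ℤ))) := by
  set k : ℕ := ∑ i, α i
  choose Cf hCf hCfb using
    exists_norm_iteratedFDeriv_inv_pow_le (E := EuclideanSpace ℂ (Fin n)) k
  have hterm : ∀ l, 0 < 2 * 4 ^ k * (Cf (l + 1) * Cf (n - 1 - l)) := fun l =>
    mul_pos (by positivity) (mul_pos (hCf _) (hCf _))
  refine ⟨∑ l ∈ Finset.range n, 2 * 4 ^ k * (Cf (l + 1) * Cf (n - 1 - l)),
    Finset.sum_pos (fun l _ => hterm l) ⟨0, Finset.mem_range.2 (by omega)⟩, ?_⟩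
  rintro l hl j κ σ ⟨hσ0, hσ1⟩ ζ z hζ hz
  have hr : (0 : ℝ) ≤ σ⁻¹ := by positivity
  have hdist : 3 * σ ≤ ‖ζ - z‖ := by
    have := norm_sub_norm_le ζ z
    linarith
  set a : EuclideanSpace ℂ (Fin n) → ℂ := fun w =>
    ((starRingEnd ℂ) (ζ j) - (starRingEnd ℂ) (w j)) * (starRingEnd ℂ) (ζ κ)
  set N : EuclideanSpace ℂ (Fin n) → ℂ := fun w => ((‖ζ - w‖ ^ 2 : ℝ) : ℂ) with hN
  set L : EuclideanSpace ℂ (Fin n) → ℂ := fun w =>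
    ∑ i, (starRingEnd ℂ) (ζ i) * (ζ i - w i)
  have hLz : 3 * σ ≤ ‖L z‖ :=
    (by linarith : 3 * σ ≤ 1 - ‖z‖).trans (le_norm_leray_denominator hζ z)
  have hNz : ‖N z‖ = ‖ζ - z‖ ^ 2 := by
    simp [hN]
  have hzζ : z ≠ ζ := by
    rintro rfl
    simp only [sub_self, norm_zero] at hdist
    linarith
  have haC : ContDiff ℝ k a := by
    have hw : ContDiff ℝ k fun w : EuclideanSpace ℂ (Fin n) => (starRingEnd ℂ) (w j) :=
      Complex.conjCLE.contDiff.comp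
        ((EuclideanSpace.proj (𝕜 := ℂ) j).restrictScalars ℝ).contDiff
    exact (contDiff_const.sub hw).mul contDiff_const
  have hNC : ContDiff ℝ k N :=
    Complex.ofRealCLM.contDiff.comp ((contDiff_const.sub contDiff_id).norm_sq ℝ)
  have hLC : ContDiff ℝ k L := by
    refine ContDiff.sum fun i _ => contDiff_const.mul (contDiff_const.sub ?_)
    exact ((EuclideanSpace.proj (𝕜 := ℂ) i).restrictScalars ℝ).contDiff
  let s : Set (EuclideanSpace ℂ (Fin n)) := {w | N w ≠ 0} ∩ {w | L w ≠ 0}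
  have hs : IsOpen s :=
    (isOpen_ne_fun hNC.continuous continuous_const).inter
      (isOpen_ne_fun hLC.continuous continuous_const)
  have hzs : z ∈ s := by
    refine ⟨norm_pos_iff.1 ?_, norm_pos_iff.1 (by linarith)⟩
    rw [hNz]
    exact pow_pos (by linarith) 2
  have hab : ∀ i ≤ k, ‖iteratedFDeriv ℝ i a z‖ ≤ 2 * σ⁻¹ ^ i := fun i _ => by
    refine norm_iteratedFDeriv_leray_numerator_le j κ hζ (by linarith) ?_ i
    exact one_le_inv_iff₀.2 ⟨hσ0, by linarith⟩
  have hNb : ∀ m ≤ k, ‖iteratedFDeriv ℝ m (fun y => (N y ^ (l + 1))⁻¹) z‖ ≤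
      Cf (l + 1) * (‖N z‖ ^ (l + 1))⁻¹ * σ⁻¹ ^ m := by
    refine hCfb (l + 1) N s z σ⁻¹ hs hzs hNC.contDiffOn (fun y hy => hy.1) hr fun i _ _ => ?_
    rw [hNz]
    refine (norm_iteratedFDeriv_ofReal_norm_sub_sq_le hzζ i).trans ?_
    have : 2 * ‖ζ - z‖⁻¹ ≤ σ⁻¹ := by
      rw [← div_eq_mul_inv, ← one_div, div_le_div_iff₀ (by linarith) hσ0]
      linarith
    gcongr
  have hLb : ∀ m ≤ k, ‖iteratedFDeriv ℝ m (fun y => (L y ^ (n - 1 - l))⁻¹) z‖ ≤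
      Cf (n - 1 - l) * (‖L z‖ ^ (n - 1 - l))⁻¹ * σ⁻¹ ^ m := by
    refine hCfb (n - 1 - l) L s z σ⁻¹ hs hzs hLC.contDiffOn (fun y hy => hy.2) hr fun i _ _ => ?_
    refine norm_iteratedFDeriv_leray_denominator_le hζ ?_ hr i
    rw [← div_eq_mul_inv, le_div_iff₀ hσ0]
    linarith
  have hNinv : ContDiffOn ℝ k (fun y => (N y ^ (l + 1))⁻¹) s :=
    (hNC.pow _).contDiffOn.inv fun y hy => pow_ne_zero _ hy.1
  have hLinv : ContDiffOn ℝ k (fun y => (L y ^ (n - 1 - l))⁻¹) s :=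
    (hLC.pow _).contDiffOn.inv fun y hy => pow_ne_zero _ hy.2
  have hfun : (fun w : EuclideanSpace ℂ (Fin n) => a w /
      (((‖ζ - w‖ : ℝ) : ℂ) ^ (2 * l + 2) * L w ^ (n - 1 - l))) =
      fun w => (a w * (N w ^ (l + 1))⁻¹) * (L w ^ (n - 1 - l))⁻¹ := by
    ext w
    have : N w ^ (l + 1) = ((‖ζ - w‖ : ℝ) : ℂ) ^ (2 * l + 2) := by
      simp only [hN]
      push_cast
      rw [← pow_mul]
      ring_nf
    rw [this, div_eq_mul_inv, mul_inv, ← mul_assoc]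
  have hlen : (multiIndexVecs n α).length = k := length_multiIndexVecs n α
  have hsmooth : ContDiffOn ℝ k
      (fun w => (a w * (N w ^ (l + 1))⁻¹) * (L w ^ (n - 1 - l))⁻¹) s :=
    (haC.contDiffOn.mul hNinv).mul hLinv
  have haN : ∀ m ≤ k, ‖iteratedFDeriv ℝ m (fun w => a w * (N w ^ (l + 1))⁻¹) z‖ ≤
      2 * (Cf (l + 1) * (‖N z‖ ^ (l + 1))⁻¹) * (2 * σ⁻¹) ^ m := fun m hm =>
    norm_iteratedFDeriv_mul_le_of_geometric hs hzs haC.contDiffOn hNinv hr zero_le_two hab hNb hm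
  have hC1 := hCf (l + 1)
  have hC2 := hCf (n - 1 - l)
  have hkey := norm_iteratedFDeriv_mul_le_of_geometric hs hzs (haC.contDiffOn.mul hNinv) hLinv
    (r := 2 * σ⁻¹) (by positivity) (by positivity) haN
    (fun m hm => (hLb m hm).trans (by gcongr; linarith)) le_rfl
  have hpd := norm_pderivIter_le (fun v hv => norm_le_one_of_mem_multiIndexVecs hv)
    (vs := multiIndexVecs n α)
    (by rw [hlen]; exact hsmooth.contDiffAt (hs.mem_nhds hzs))
  rw [hlen] at hpd
  rw [hfun]
  refine (hpd.trans hkey).trans ?_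
  have hNle : (‖N z‖ ^ (l + 1))⁻¹ ≤ σ⁻¹ ^ (2 * (l + 1)) := by
    rw [hNz, ← pow_mul, ← inv_pow]
    gcongr
    linarith
  have hLle : (‖L z‖ ^ (n - 1 - l))⁻¹ ≤ σ⁻¹ ^ (n - 1 - l) := by
    rw [← inv_pow]
    gcongr
    linarith
  have hone : 1 ≤ σ⁻¹ := one_le_inv_iff₀.2 ⟨hσ0, by linarith⟩
  have hzpow : σ ^ (-(2 * (n : ℤ) + (k : ℤ))) = σ⁻¹ ^ (2 * n + k) := by
    rw [zpow_neg, ← inv_zpow, ← zpow_natCast]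
    push_cast
    rfl
  rw [hzpow]
  calc 2 * (Cf (l + 1) * (‖N z‖ ^ (l + 1))⁻¹) * (Cf (n - 1 - l) * (‖L z‖ ^ (n - 1 - l))⁻¹) *
        (2 * (2 * σ⁻¹)) ^ k
      ≤ 2 * (Cf (l + 1) * σ⁻¹ ^ (2 * (l + 1))) * (Cf (n - 1 - l) * σ⁻¹ ^ (n - 1 - l)) *
        (2 * (2 * σ⁻¹)) ^ k := by gcongr
    _ = 2 * 4 ^ k * (Cf (l + 1) * Cf (n - 1 - l)) *
        σ⁻¹ ^ (2 * (l + 1) + (n - 1 - l) + k) := by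
      rw [show 2 * (2 * σ⁻¹) = 4 * σ⁻¹ by ring, mul_pow, pow_add, pow_add]
      ring
    _ ≤ (∑ l ∈ Finset.range n, 2 * 4 ^ k * (Cf (l + 1) * Cf (n - 1 - l))) *
        σ⁻¹ ^ (2 * n + k) := by
      refine mul_le_mul ?_ (pow_le_pow_right₀ hone (by omega)) (by positivity)
        (Finset.sum_nonneg fun l _ => (hterm l).le)
      exact Finset.single_le_sum (f := fun l => 2 * 4 ^ k * (Cf (l + 1) * Cf (n - 1 - l)))
        (fun l _ => (hterm l).le) (Finset.mem_range.2 (by omega))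
end
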